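/- arXiv:2207.01444 — 4 statements merged into one kernel-verified Lean document; each statement's English description precedes it below -/
import Mathlib

section
/- Let X, Y be real Banach spaces, let A : X → Y be a continuous linear equivalence with ‖A⁻¹‖ > 0, set 𝒞 := 1/(5‖A⁻¹‖), and let ε > 0. Suppose F : X → Y is Fréchet differentiable at every point of the closed ball {g ∈ X : ‖g‖ ≤ ε} with derivative DF(g), and satisfies: (i) ‖F(g') − F(g) − DF(g)(g' − g)‖ ≤ 𝒞‖g' − g‖ for all g, g' with ‖g‖ ≤ ε and ‖g'‖ ≤ ε; (ii) ‖DF(g) − A‖ ≤ 𝒞 in operator norm for all g with ‖g‖ ≤ ε. Let g₀ ∈ X satisfy ‖g₀‖ ≤ ε/2 and ‖A⁻¹‖·‖F(g₀)‖ ≤ ε/4, and define the modified Newton sequence g_{n+1} := g_n − A⁻¹(F(g_n)). Then for every n ≥ 0 one has: ‖g_n‖ ≤ ε, ‖F(g_n)‖ ≤ 2^{−n}‖F(g₀)‖, and ‖g_{n+1} − g_n‖ ≤ 2^{−n}‖A⁻¹‖‖F(g₀)‖. -/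
/-- Inductive estimates for the modified Newton sequence `g_{n+1} = g_n - A⁻¹ (F (g_n))`,
where the linearization point is kept fixed (Proposition 6.4 of the paper, abstracted to
arbitrary real Banach spaces). -/
theorem newton_iteration_inductive_estimates
    {X Y : Type*} [NormedAddCommGroup X] [NormedSpace ℝ X] [CompleteSpace X]
    [NormedAddCommGroup Y] [NormedSpace ℝ Y] [CompleteSpace Y]
    (A : X ≃L[ℝ] Y) (hA : 0 < ‖(A.symm : Y →L[ℝ] X)‖)
    (ε : ℝ) (hε : 0 < ε)
    (F : X → Y) (DF : X → X →L[ℝ] Y)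
    (hdiff : ∀ g : X, ‖g‖ ≤ ε → HasFDerivAt F (DF g) g)
    (hTaylor : ∀ g g' : X, ‖g‖ ≤ ε → ‖g'‖ ≤ ε →
      ‖F g' - F g - DF g (g' - g)‖ ≤ (1 / (5 * ‖(A.symm : Y →L[ℝ] X)‖)) * ‖g' - g‖)
    (hDF : ∀ g : X, ‖g‖ ≤ ε →
      ‖DF g - (A : X →L[ℝ] Y)‖ ≤ 1 / (5 * ‖(A.symm : Y →L[ℝ] X)‖))
    (g : ℕ → X)
    (hg0 : ‖g 0‖ ≤ ε / 2)
    (hg0' : ‖(A.symm : Y →L[ℝ] X)‖ * ‖F (g 0)‖ ≤ ε / 4)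
    (hrec : ∀ n : ℕ, g (n + 1) = g n - A.symm (F (g n))) :
    ∀ n : ℕ, ‖g n‖ ≤ ε ∧ ‖F (g n)‖ ≤ (1 / 2 : ℝ) ^ n * ‖F (g 0)‖ ∧
      ‖g (n + 1) - g n‖ ≤ (1 / 2 : ℝ) ^ n * ‖(A.symm : Y →L[ℝ] X)‖ * ‖F (g 0)‖ := by
  set M := ‖(A.symm : Y →L[ℝ] X)‖
  have hstep : ∀ n, ‖g (n + 1) - g n‖ ≤ M * ‖F (g n)‖ := fun n => by
    rw [hrec n, sub_sub_cancel_left, norm_neg]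
    exact (A.symm : Y →L[ℝ] X).le_opNorm (F (g n))
  have hcontract : ∀ n, ‖g n‖ ≤ ε → ‖g (n + 1)‖ ≤ ε →
      ‖F (g (n + 1))‖ ≤ 1 / 2 * ‖F (g n)‖ := fun n hn hn' => by
    have hres : F (g (n + 1)) = (F (g (n + 1)) - F (g n) - DF (g n) (g (n + 1) - g n)) +
        (DF (g n) - (A : X →L[ℝ] Y)) (g (n + 1) - g n) := by
      have hlin : A (g (n + 1) - g n) = -F (g n) := by
        rw [hrec n, sub_sub_cancel_left, map_neg, A.apply_symm_apply]
      rw [sub_apply, ContinuousLinearEquiv.coe_coe, hlin]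
      abel
    calc ‖F (g (n + 1))‖
        ≤ 1 / (5 * M) * ‖g (n + 1) - g n‖ + 1 / (5 * M) * ‖g (n + 1) - g n‖ := by
          rw [hres]
          exact norm_add_le_of_le (hTaylor _ _ hn hn')
            (ContinuousLinearMap.le_of_opNorm_le _ (hDF _ hn) _)
      _ ≤ 1 / (5 * M) * (M * ‖F (g n)‖) + 1 / (5 * M) * (M * ‖F (g n)‖) := by
          gcongr <;> exact hstep n
      _ = 2 / 5 * ‖F (g n)‖ := by field_simp; ring
      _ ≤ 1 / 2 * ‖F (g n)‖ := by linarith [norm_nonneg (F (g n))]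
  have hdecay : ∀ n, ‖F (g n)‖ ≤ (1 / 2 : ℝ) ^ n * ‖F (g 0)‖ →
      ‖g (n + 1) - g n‖ ≤ (1 / 2 : ℝ) ^ n * (M * ‖F (g 0)‖) := fun n hn =>
    (hstep n).trans <| (mul_le_mul_of_nonneg_left hn hA.le).trans_eq (by ring)
  have hball : ∀ n, ‖g n‖ ≤ ε / 2 + 2 * (1 - (1 / 2 : ℝ) ^ n) * (M * ‖F (g 0)‖) →
      ‖g n‖ ≤ ε := fun n hn => by
    have hpos : 0 ≤ (1 / 2 : ℝ) ^ n * (M * ‖F (g 0)‖) := by positivity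
    linarith
  have key : ∀ n, ‖g n‖ ≤ ε / 2 + 2 * (1 - (1 / 2 : ℝ) ^ n) * (M * ‖F (g 0)‖) ∧
      ‖F (g n)‖ ≤ (1 / 2 : ℝ) ^ n * ‖F (g 0)‖ := fun n => by
    induction n with
    | zero => simpa using hg0
    | succ n ih =>
      obtain ⟨hgn, hFn⟩ := ih
      have hgn' : ‖g (n + 1)‖ ≤
          ε / 2 + 2 * (1 - (1 / 2 : ℝ) ^ (n + 1)) * (M * ‖F (g 0)‖) := by
        have htri := norm_le_norm_add_norm_sub (g n) (g (n + 1))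
        rw [norm_sub_rev] at htri
        have hd := hdecay n hFn
        rw [pow_succ]
        linarith
      refine ⟨hgn', (hcontract n (hball n hgn) (hball _ hgn')).trans ?_⟩
      rw [pow_succ]
      linarith
  exact fun n => ⟨hball n (key n).1, (key n).2,
    (hdecay n (key n).2).trans_eq (mul_assoc _ _ _).symm⟩
end

section
/- Let X, Y be real Banach spaces, let A : X → Y be a continuous linear equivalence with ‖A⁻¹‖ > 0, set 𝒞 := 1/(5‖A⁻¹‖), and let ε > 0. Suppose F : X → Y is Fréchet differentiable at every point of the closed ball {g ∈ X : ‖g‖ ≤ ε} with derivative DF(g), and satisfies: (i) ‖F(g') − F(g) − DF(g)(g' − g)‖ ≤ 𝒞‖g' − g‖ for all g, g' with ‖g‖ ≤ ε and ‖g'‖ ≤ ε; (ii) ‖DF(g) − A‖ ≤ 𝒞 in operator norm for all g with ‖g‖ ≤ ε. Let g₀ ∈ X satisfy ‖g₀‖ ≤ ε/2 and ‖A⁻¹‖·‖F(g₀)‖ ≤ ε/4, and define g_{n+1} := g_n − A⁻¹(F(g_n)). Then the sequence (g_n) converges in X to some f with ‖f‖ ≤ ε, F(f) = 0, and ‖f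 − g₀‖ ≤ 2‖A⁻¹‖‖F(g₀)‖. -/
/-- One step of the modified Newton iteration at least halves the residual, provided both points
lie in the ball where `F` is uniformly close to its linearization and `DF` is close to `A`. -/
theorem norm_apply_newton_step_le
    {X Y : Type*} [NormedAddCommGroup X] [NormedSpace ℝ X]
    [NormedAddCommGroup Y] [NormedSpace ℝ Y]
    (A : X ≃L[ℝ] Y) (hA : 0 < ‖(A.symm : Y →L[ℝ] X)‖) (F : X → Y) (L : X →L[ℝ] Y) (x x' : X)
    (hTaylor : ‖F x' - F x - L (x' - x)‖ ≤
      (1 / (5 * ‖(A.symm : Y →L[ℝ] X)‖)) * ‖x' - x‖)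
    (hL : ‖L - (A : X →L[ℝ] Y)‖ ≤ 1 / (5 * ‖(A.symm : Y →L[ℝ] X)‖))
    (hx' : x' = x - A.symm (F x)) :
    ‖F x'‖ ≤ ‖F x‖ / 2 := by
  set M := ‖(A.symm : Y →L[ℝ] X)‖ with hM
  have hdiff : x' - x = -A.symm (F x) := by rw [hx']; abel
  have hstep : ‖x' - x‖ ≤ M * ‖F x‖ := by
    rw [hdiff, norm_neg]
    exact (A.symm : Y →L[ℝ] X).le_opNorm (F x)
  have hsplit : F x' = (F x' - F x - L (x' - x)) + (L - (A : X →L[ℝ] Y)) (x' - x) := by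
    have hlin : A (x' - x) = -F x := by rw [hdiff]; simp
    rw [sub_apply, ContinuousLinearEquiv.coe_coe, hlin]
    abel
  have hlin : ‖(L - (A : X →L[ℝ] Y)) (x' - x)‖ ≤ (1 / (5 * M)) * ‖x' - x‖ :=
    (L - (A : X →L[ℝ] Y)).le_of_opNorm_le hL _
  calc ‖F x'‖ ≤ (1 / (5 * M)) * ‖x' - x‖ + (1 / (5 * M)) * ‖x' - x‖ := by
        rw [hsplit]
        exact (norm_add_le _ _).trans (add_le_add hTaylor hlin)
    _ = (2 / (5 * M)) * ‖x' - x‖ := by ring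
    _ ≤ (2 / (5 * M)) * (M * ‖F x‖) := by gcongr
    _ = 2 / 5 * ‖F x‖ := by field_simp
    _ ≤ ‖F x‖ / 2 := by linarith [norm_nonneg (F x)]

/-- Existence and error estimate for the zero produced by the modified Newton sequence
`g_{n+1} = g_n - A⁻¹ (F (g_n))` (Proposition 6.4 of the paper, abstracted to arbitrary
real Banach spaces). -/
theorem newton_iteration_convergence
    {X Y : Type*} [NormedAddCommGroup X] [NormedSpace ℝ X] [CompleteSpace X]
    [NormedAddCommGroup Y] [NormedSpace ℝ Y] [CompleteSpace Y]
    (A : X ≃L[ℝ] Y) (hA : 0 < ‖(A.symm : Y →L[ℝ] X)‖)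
    (ε : ℝ) (hε : 0 < ε)
    (F : X → Y) (DF : X → X →L[ℝ] Y)
    (hdiff : ∀ g : X, ‖g‖ ≤ ε → HasFDerivAt F (DF g) g)
    (hTaylor : ∀ g g' : X, ‖g‖ ≤ ε → ‖g'‖ ≤ ε →
      ‖F g' - F g - DF g (g' - g)‖ ≤ (1 / (5 * ‖(A.symm : Y →L[ℝ] X)‖)) * ‖g' - g‖)
    (hDF : ∀ g : X, ‖g‖ ≤ ε →
      ‖DF g - (A : X →L[ℝ] Y)‖ ≤ 1 / (5 * ‖(A.symm : Y →L[ℝ] X)‖))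
    (g : ℕ → X)
    (hg0 : ‖g 0‖ ≤ ε / 2)
    (hg0' : ‖(A.symm : Y →L[ℝ] X)‖ * ‖F (g 0)‖ ≤ ε / 4)
    (hrec : ∀ n : ℕ, g (n + 1) = g n - A.symm (F (g n))) :
    ∃ f : X, Filter.Tendsto g Filter.atTop (nhds f) ∧ ‖f‖ ≤ ε ∧ F f = 0 ∧
      ‖f - g 0‖ ≤ 2 * ‖(A.symm : Y →L[ℝ] X)‖ * ‖F (g 0)‖ := by
  set M := ‖(A.symm : Y →L[ℝ] X)‖ with hM
  set K := ‖F (g 0)‖ with hK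
  have hK0 : 0 ≤ K := norm_nonneg _
  have hstep (n : ℕ) : ‖g (n + 1) - g n‖ ≤ M * ‖F (g n)‖ := by
    have h : g (n + 1) - g n = -A.symm (F (g n)) := by rw [hrec]; abel
    rw [h, norm_neg]
    exact (A.symm : Y →L[ℝ] X).le_opNorm (F (g n))
  have hball (n : ℕ) (h : ‖g n - g 0‖ ≤ 2 * M * K * (1 - 1 / 2 ^ n)) : ‖g n‖ ≤ ε := by
    have h1 : ‖g n‖ ≤ ‖g n - g 0‖ + ‖g 0‖ := norm_le_norm_sub_add _ _
    have h2 : 0 ≤ M * K * (1 / 2 ^ n) := by positivity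
    linarith
  have hind (n : ℕ) : ‖F (g n)‖ ≤ K / 2 ^ n ∧ ‖g n - g 0‖ ≤ 2 * M * K * (1 - 1 / 2 ^ n) := by
    induction n with
    | zero => simp [hK]
    | succ n ih =>
      obtain ⟨hF, hg⟩ := ih
      have hg' : ‖g (n + 1) - g 0‖ ≤ 2 * M * K * (1 - 1 / 2 ^ (n + 1)) :=
        calc ‖g (n + 1) - g 0‖ ≤ ‖g (n + 1) - g n‖ + ‖g n - g 0‖ :=
              norm_sub_le_norm_sub_add_norm_sub _ _ _
          _ ≤ M * (K / 2 ^ n) + 2 * M * K * (1 - 1 / 2 ^ n) :=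
              add_le_add ((hstep n).trans (by gcongr)) hg
          _ = 2 * M * K * (1 - 1 / 2 ^ (n + 1)) := by rw [pow_succ]; field_simp; ring
      refine ⟨?_, hg'⟩
      have hn := hball n hg
      calc ‖F (g (n + 1))‖ ≤ ‖F (g n)‖ / 2 :=
            norm_apply_newton_step_le A hA F (DF (g n)) (g n) (g (n + 1))
              (hTaylor _ _ hn (hball _ hg')) (hDF _ hn) (hrec n)
        _ ≤ K / 2 ^ n / 2 := by gcongr
        _ = K / 2 ^ (n + 1) := by rw [pow_succ, div_div]
  have hdist (n : ℕ) : dist (g n) (g (n + 1)) ≤ 2 * M * K / 2 / 2 ^ n := by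
    rw [dist_comm, dist_eq_norm]
    calc ‖g (n + 1) - g n‖ ≤ M * (K / 2 ^ n) := (hstep n).trans (by gcongr; exact (hind n).1)
      _ = 2 * M * K / 2 / 2 ^ n := by ring
  obtain ⟨f, hf⟩ := cauchySeq_tendsto_of_complete (cauchySeq_of_le_geometric_two hdist)
  have hfε : ‖f‖ ≤ ε := le_of_tendsto' hf.norm fun n => hball n (hind n).2
  refine ⟨f, hf, hfε, ?_, ?_⟩
  · have hzero : Filter.Tendsto (fun n => F (g n)) Filter.atTop (nhds 0) := by
      refine squeeze_zero_norm (fun n => (hind n).1) ?_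
      exact tendsto_const_nhds.div_atTop
        (tendsto_pow_atTop_atTop_of_one_lt (one_lt_two : (1 : ℝ) < 2))
    exact tendsto_nhds_unique ((hdiff f hfε).continuousAt.tendsto.comp hf) hzero
  · rw [← dist_eq_norm, dist_comm]
    exact dist_le_of_le_geometric_two_of_tendsto₀ hdist hf
end

section
/- Let P be a topological space, X and Y real Banach spaces, and ε > 0, M > 0; set 𝒞 := 1/(5M). Suppose: F : P × X → Y is continuous; for each p ∈ P there is a continuous linear equivalence A_p : X → Y such that the maps p ↦ A_p and p ↦ A_p⁻¹ are continuous in operator norm and ‖A_p⁻¹‖ ≤ M for all p; for each p the map F(p,·) is Fréchet differentiable on {g : ‖g‖ ≤ ε} with derivative D₂F(p,g), jointly continuous in (p,g) in operator norm, and satisfying (i) ‖F(p,g') − F(p,g) − D₂F(p,g)(g' − g)‖ ≤ 𝒞‖g' − g‖ for all ‖g‖,‖g'‖ ≤ ε and (ii) ‖D₂F(p,g) − A_p‖ ≤ 𝒞 for all ‖g‖ ≤ ε; and g₀ : P → X is continuous with ‖g₀(p)‖ ≤ ε/2 and M·‖F(p, g₀(p))‖ ≤ ε/4 for all p. Then there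 exists a continuous map f : P → X such that for every p ∈ P: ‖f(p)‖ ≤ ε, F(p, f(p)) = 0, and ‖f(p) − g₀(p)‖ ≤ 2M‖F(p, g₀(p))‖. -/
/-- Let `T` contract distances by a factor `1 / 2` on a closed ball containing the closed ball of
radius `2 * dist x (T x)` around `x`. Then the orbit of `x` stays within distance
`2 * dist x (T x) * (1 - 2⁻ⁿ)` of `x`, and consecutive distances decay geometrically. -/
theorem dist_iterate_le_of_half_contraction {E : Type*} [PseudoMetricSpace E] {T : E → E}
    {c x : E} {r : ℝ}
    (hT : ∀ y ∈ Metric.closedBall c r, ∀ z ∈ Metric.closedBall c r,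
      dist (T y) (T z) ≤ 1 / 2 * dist y z)
    (hx : dist x c + 2 * dist x (T x) ≤ r) (n : ℕ) :
    dist (T^[n] x) x ≤ 2 * dist x (T x) * (1 - (1 / 2) ^ n) ∧
      dist (T^[n] x) (T^[n + 1] x) ≤ dist x (T x) * (1 / 2) ^ n := by
  have mem : ∀ (n : ℕ) (y : E), dist y x ≤ 2 * dist x (T x) * (1 - (1 / 2) ^ n) →
      y ∈ Metric.closedBall c r := fun n y hy => by
    have hpow : 0 ≤ dist x (T x) * (1 / 2 : ℝ) ^ n := by positivity
    rw [Metric.mem_closedBall]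
    linarith [dist_triangle y x c]
  induction n with
  | zero => simp
  | succ n ih =>
    obtain ⟨h₁, h₂⟩ := ih
    have h₃ : dist (T^[n + 1] x) x ≤ 2 * dist x (T x) * (1 - (1 / 2) ^ (n + 1)) := by
      have := dist_triangle_left (T^[n + 1] x) x (T^[n] x)
      rw [pow_succ]
      linarith
    refine ⟨h₃, ?_⟩
    have h₄ := hT _ (mem n _ h₁) _ (mem (n + 1) _ h₃)
    rw [← Function.iterate_succ_apply' T, ← Function.iterate_succ_apply' T] at h₄
    rw [pow_succ]
    linarith

/-- A continuous family of self-maps, uniformly contracting by a factor `1 / 2` on a closed ball,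
has a continuous family of fixed points close to any continuous family of approximate ones. -/
theorem exists_continuous_fixedPoint_of_half_contraction
    {P E : Type*} [TopologicalSpace P] [MetricSpace E] [CompleteSpace E]
    {T : P → E → E} (hTcont : Continuous fun q : P × E => T q.1 q.2) {c : E} {r : ℝ}
    (hT : ∀ p, ∀ y ∈ Metric.closedBall c r, ∀ z ∈ Metric.closedBall c r,
      dist (T p y) (T p z) ≤ 1 / 2 * dist y z)
    {x : P → E} (hxcont : Continuous x)
    (hx : ∀ p, dist (x p) c + 2 * dist (x p) (T p (x p)) ≤ r) :
    ∃ f : P → E, Continuous f ∧ ∀ p, T p (f p) = f p ∧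
      dist (f p) (x p) ≤ 2 * dist (x p) (T p (x p)) := by
  have hstep : ∀ p n, dist ((T p)^[n] (x p)) ((T p)^[n + 1] (x p)) ≤
      2 * dist (x p) (T p (x p)) / 2 / 2 ^ n := fun p n => by
    refine (dist_iterate_le_of_half_contraction (hT p) (hx p) n).2.trans_eq ?_
    rw [one_div, inv_pow]
    ring
  choose f hf using fun p =>
    cauchySeq_tendsto_of_complete (cauchySeq_of_le_geometric_two (hstep p))
  have hcont : ∀ n, Continuous fun p => (T p)^[n] (x p) := fun n => by
    induction n with
    | zero => exact hxcont
    | succ n ih =>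
      simp only [Function.iterate_succ_apply']
      exact hTcont.comp (continuous_id.prodMk ih)
  refine ⟨f, ?_, fun p => ⟨?_, ?_⟩⟩
  · have hunif : TendstoUniformly (fun n p => (T p)^[n] (x p)) f Filter.atTop := by
      have hlim : Filter.Tendsto (fun n : ℕ => r * (1 / 2 : ℝ) ^ n) Filter.atTop (nhds 0) := by
        simpa using (tendsto_pow_atTop_nhds_zero_of_lt_one (r := (1 / 2 : ℝ))
          (by norm_num) (by norm_num)).const_mul r
      rw [Metric.tendstoUniformly_iff]
      intro δ hδ
      filter_upwards [hlim.eventually_lt_const hδ] with n hn p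
      rw [dist_comm]
      refine (dist_le_of_le_geometric_two_of_tendsto (hstep p) (hf p) n).trans_lt
        (lt_of_le_of_lt ?_ hn)
      rw [one_div, inv_pow, ← div_eq_mul_inv]
      gcongr
      linarith [hx p, dist_nonneg (x := x p) (y := c)]
    exact hunif.continuous (Filter.Frequently.of_forall hcont)
  · have hTp : Continuous (T p) := hTcont.comp (Continuous.prodMk_right p)
    exact isFixedPt_of_tendsto_iterate (hf p) hTp.continuousAt
  · rw [dist_comm]
    exact dist_le_of_le_geometric_two_of_tendsto₀ (hstep p) (hf p)

/-- If `F` is approximated by an invertible linear map `A` with an error of slope at most `C`,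
then the modified Newton map `y ↦ y - A⁻¹ (F y)` contracts with constant `‖A⁻¹‖ * C`. -/
theorem norm_newton_sub_newton_le {X Y : Type*} [NormedAddCommGroup X] [NormedSpace ℝ X]
    [NormedAddCommGroup Y] [NormedSpace ℝ Y] (A : X ≃L[ℝ] Y) {F : X → Y} {y z : X} {C : ℝ}
    (h : ‖F y - F z - A (y - z)‖ ≤ C * ‖y - z‖) :
    ‖(y - A.symm (F y)) - (z - A.symm (F z))‖ ≤
      ‖(A.symm : Y →L[ℝ] X)‖ * (C * ‖y - z‖) := by
  have heq : (y - A.symm (F y)) - (z - A.symm (F z)) =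
      -(A.symm : Y →L[ℝ] X) (F y - F z - A (y - z)) := by
    simp only [map_sub, ContinuousLinearEquiv.coe_coe, ContinuousLinearEquiv.symm_apply_apply]
    abel
  rw [heq, norm_neg]
  exact (ContinuousLinearMap.le_opNorm _ _).trans (by gcongr)


/-- Parametrized quantitative implicit function theorem: uniform geometric convergence of the
modified Newton scheme yields a continuous family `p ↦ f p` of zeros of `F (p, ·)`
(continuity statement of Proposition 6.4 of the paper, abstracted to arbitrary
real Banach spaces and an arbitrary topological parameter space). -/
theorem parametrized_newton_continuous_zero
    {P : Type*} [TopologicalSpace P]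
    {X Y : Type*} [NormedAddCommGroup X] [NormedSpace ℝ X] [CompleteSpace X]
    [NormedAddCommGroup Y] [NormedSpace ℝ Y] [CompleteSpace Y]
    (ε M : ℝ) (hε : 0 < ε) (hM : 0 < M)
    (F : P × X → Y) (hF : Continuous F)
    (A : P → (X ≃L[ℝ] Y))
    (hAcont : Continuous fun p : P => ((A p) : X →L[ℝ] Y))
    (hAinvcont : Continuous fun p : P => (((A p).symm) : Y →L[ℝ] X))
    (hAinvbound : ∀ p : P, ‖(((A p).symm) : Y →L[ℝ] X)‖ ≤ M)
    (D₂F : P → X → (X →L[ℝ] Y))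
    (hdiff : ∀ p : P, ∀ g : X, ‖g‖ ≤ ε → HasFDerivAt (fun x => F (p, x)) (D₂F p g) g)
    (hD₂cont : ContinuousOn (fun q : P × X => D₂F q.1 q.2) {q : P × X | ‖q.2‖ ≤ ε})
    (hTaylor : ∀ p : P, ∀ g g' : X, ‖g‖ ≤ ε → ‖g'‖ ≤ ε →
      ‖F (p, g') - F (p, g) - D₂F p g (g' - g)‖ ≤ (1 / (5 * M)) * ‖g' - g‖)
    (hDF : ∀ p : P, ∀ g : X, ‖g‖ ≤ ε →
      ‖D₂F p g - ((A p) : X →L[ℝ] Y)‖ ≤ 1 / (5 * M))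
    (g₀ : P → X) (hg₀cont : Continuous g₀)
    (hg₀norm : ∀ p : P, ‖g₀ p‖ ≤ ε / 2)
    (hg₀F : ∀ p : P, M * ‖F (p, g₀ p)‖ ≤ ε / 4) :
    ∃ f : P → X, Continuous f ∧ ∀ p : P, ‖f p‖ ≤ ε ∧ F (p, f p) = 0 ∧
      ‖f p - g₀ p‖ ≤ 2 * M * ‖F (p, g₀ p)‖ := by
  have happrox : ∀ p y z, ‖y‖ ≤ ε → ‖z‖ ≤ ε →
      ‖F (p, y) - F (p, z) - A p (y - z)‖ ≤ 2 / (5 * M) * ‖y - z‖ := fun p y z hy hz => by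
    have h₁ := hTaylor p z y hz hy
    have h₂ := ContinuousLinearMap.le_of_opNorm_le _ (hDF p z hz) (y - z)
    calc ‖F (p, y) - F (p, z) - A p (y - z)‖
        = ‖(F (p, y) - F (p, z) - D₂F p z (y - z)) +
            (D₂F p z - (A p : X →L[ℝ] Y)) (y - z)‖ := by simp
      _ ≤ 1 / (5 * M) * ‖y - z‖ + 1 / (5 * M) * ‖y - z‖ := norm_add_le_of_le h₁ h₂
      _ = 2 / (5 * M) * ‖y - z‖ := by ring
  have hfirst : ∀ p, dist (g₀ p) (g₀ p - (A p).symm (F (p, g₀ p))) ≤ M * ‖F (p, g₀ p)‖ :=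
    fun p => by
      rw [dist_eq_norm, sub_sub_cancel]
      exact ContinuousLinearMap.le_of_opNorm_le _ (hAinvbound p) (F (p, g₀ p))
  obtain ⟨f, hfcont, hf⟩ := exists_continuous_fixedPoint_of_half_contraction
    (T := fun p y => y - (A p).symm (F (p, y))) (c := 0) (r := ε)
    (continuous_snd.sub ((hAinvcont.comp continuous_fst).clm_apply hF))
    (fun p y hy z hz => by
      rw [mem_closedBall_zero_iff] at hy hz
      rw [dist_eq_norm, dist_eq_norm]
      calc _ ≤ ‖((A p).symm : Y →L[ℝ] X)‖ * (2 / (5 * M) * ‖y - z‖) :=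
            norm_newton_sub_newton_le (A p) (F := fun x => F (p, x)) (happrox p y z hy hz)
        _ ≤ M * (2 / (5 * M) * ‖y - z‖) := by gcongr; exact hAinvbound p
        _ = 2 / 5 * ‖y - z‖ := by field_simp
        _ ≤ 1 / 2 * ‖y - z‖ := mul_le_mul_of_nonneg_right (by norm_num) (norm_nonneg _))
    hg₀cont
    (fun p => by
      rw [dist_zero_right]
      linarith [hfirst p, hg₀norm p, hg₀F p])
  refine ⟨f, hfcont, fun p => ?_⟩
  obtain ⟨hfix, hdist⟩ := hf p
  rw [dist_eq_norm] at hdist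
  have hclose : ‖f p - g₀ p‖ ≤ 2 * M * ‖F (p, g₀ p)‖ := by linarith [hfirst p]
  refine ⟨?_, ?_, hclose⟩
  · linarith [norm_le_norm_add_norm_sub' (f p) (g₀ p), hg₀norm p, hg₀F p]
  · simpa using hfix
end

section
/- Let U ⊆ ℝ² be open, let φ : U → ℝ be continuously differentiable, let K ⊆ U be compact, let T : K → L(ℝ², ℝ²) be a continuous map into linear maps of the plane, and let v₀ > 0 be such that w + r T(w)u ∈ U for all w ∈ K, r ∈ [0, v₀] and ‖u‖ ≤ 1. Define G : K × [0, v₀] → C(B̄(0,1), ℝ) (continuous real-valued functions on the closed unit ball, with the supremum norm) by G(w, r)(u) := (φ(w + r T(w)u) − φ(w))/r for r > 0, and G(w, 0)(u) := ⟨∇φ(w), T(w)u⟩. Then G is continuous, and its image { G(w,r) : w ∈ K, r ∈ [0, v₀] } is a compact subset of C(B̄(0,1), ℝ). -/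
open Filter Topology in
/-- The difference quotient of a `C¹` function, extended by the derivative at scale `0`, is jointly
continuous in base point, scale and direction. -/
theorem continuousAt_differenceQuotient {E F : Type*} [NormedAddCommGroup E] [NormedSpace ℝ E]
    [NormedAddCommGroup F] [NormedSpace ℝ F] {f : E → F} {x : E} {r : ℝ} {h : E}
    (hx : ContDiffAt ℝ 1 f x) (hxr : ContinuousAt f (x + r • h)) :
    ContinuousAt (fun p : E × ℝ × E ↦ if p.2.1 = 0 then fderiv ℝ f p.1 p.2.2
      else p.2.1⁻¹ • (f (p.1 + p.2.1 • p.2.2) - f p.1)) (x, r, h) := by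
  rcases eq_or_ne r 0 with rfl | hr
  · have hstrict : HasStrictFDerivAt f (fderiv ℝ f x) x := hx.hasStrictFDerivAt one_ne_zero
    have hlim : Tendsto (fun p : E × ℝ × E ↦ (p.1 + p.2.1 • p.2.2, p.1))
        (𝓝 (x, 0, h)) (𝓝 (x, x)) := by
      have : Continuous (fun p : E × ℝ × E ↦ (p.1 + p.2.1 • p.2.2, p.1)) := by fun_prop
      simpa using this.tendsto (x, 0, h)
    have hfst : Tendsto (fun p : E × ℝ × E ↦ p.1) (𝓝 (x, 0, h)) (𝓝 x) :=
      continuous_fst.tendsto (x, 0, h)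
    have hsnd : Tendsto (fun p : E × ℝ × E ↦ p.2.2) (𝓝 (x, 0, h)) (𝓝 h) :=
      (continuous_snd.comp continuous_snd).tendsto (x, 0, h)
    have hfderiv : Tendsto (fun p : E × ℝ × E ↦ fderiv ℝ f p.1) (𝓝 (x, 0, h))
        (𝓝 (fderiv ℝ f x)) :=
      (hx.fderiv_right (m := 0) (by simp)).continuousAt.tendsto.comp hfst
    have hlittle : (fun p : E × ℝ × E ↦ (if p.2.1 = 0 then fderiv ℝ f p.1 p.2.2
        else p.2.1⁻¹ • (f (p.1 + p.2.1 • p.2.2) - f p.1)) - fderiv ℝ f x p.2.2)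
        =o[𝓝 (x, 0, h)] fun p ↦ p.2.2 := by
      refine Asymptotics.isLittleO_iff.2 fun c hc ↦ ?_
      filter_upwards [Asymptotics.isLittleO_iff.1 (hstrict.isLittleO.comp_tendsto hlim) hc,
        Metric.tendsto_nhds.1 hfderiv c hc] with p hp hp'
      split_ifs with h0
      · rw [dist_eq_norm] at hp'
        rw [← sub_apply]
        exact ContinuousLinearMap.le_of_opNorm_le _ hp'.le _
      · simp only [Function.comp_apply, add_sub_cancel_left, map_smul, norm_smul] at hp
        have hpos : 0 < ‖p.2.1‖ := norm_pos_iff.2 h0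
        have heq : p.2.1⁻¹ • (f (p.1 + p.2.1 • p.2.2) - f p.1) - fderiv ℝ f x p.2.2 =
            p.2.1⁻¹ • (f (p.1 + p.2.1 • p.2.2) - f p.1 - p.2.1 • fderiv ℝ f x p.2.2) := by
          rw [smul_sub _ (f _ - f _), inv_smul_smul₀ h0]
        rw [heq, norm_smul, norm_inv, inv_mul_le_iff₀ hpos]
        linarith
    have hzero := (Asymptotics.isLittleO_one_iff ℝ).1 (hlittle.trans_isBigO (hsnd.isBigO_one ℝ))
    have := hzero.add (((fderiv ℝ f x).continuous.tendsto h).comp hsnd)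
    simpa [ContinuousAt] using this
  · have hlim : ContinuousAt (fun p : E × ℝ × E ↦ p.1 + p.2.1 • p.2.2) (x, r, h) := by fun_prop
    have hr' : ContinuousAt (fun p : E × ℝ × E ↦ p.2.1) (x, r, h) := by fun_prop
    have hquot : ContinuousAt (fun p : E × ℝ × E ↦
        p.2.1⁻¹ • (f (p.1 + p.2.1 • p.2.2) - f p.1)) (x, r, h) :=
      (hr'.inv₀ hr).smul ((hxr.comp_of_eq hlim rfl).sub
        (hx.continuousAt.comp_of_eq continuousAt_fst rfl))
    refine hquot.congr ?_
    filter_upwards [hr'.eventually_ne hr] with p hp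
    rw [if_neg hp]


/-- `C⁰` version of Lemma 6.1 of the paper: the map `G` sending `(w, r)` to the limit shape
`φ` rescaled around `w ∈ K` at scale `r ∈ [0, v₀]` via the affine map `x ↦ w + r T(w) x`
(with `G(w,0)` the linear map `u ↦ Dφ(w)(T(w)u)`) is continuous into `C(B̄(0,1), ℝ)`,
and its image is compact. -/
theorem rescaled_limit_shapes_continuous_and_compact
    {φ : EuclideanSpace ℝ (Fin 2) → ℝ} {U K : Set (EuclideanSpace ℝ (Fin 2))}
    (hU : IsOpen U) (hφ : ContDiffOn ℝ 1 φ U)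
    (hK : IsCompact K) (hKU : K ⊆ U)
    (T : EuclideanSpace ℝ (Fin 2) →
      (EuclideanSpace ℝ (Fin 2) →L[ℝ] EuclideanSpace ℝ (Fin 2)))
    (hT : ContinuousOn T K)
    (v₀ : ℝ) (hv₀ : 0 < v₀)
    (hdom : ∀ w ∈ K, ∀ r ∈ Set.Icc (0 : ℝ) v₀,
      ∀ u : EuclideanSpace ℝ (Fin 2), ‖u‖ ≤ 1 → w + r • (T w u) ∈ U)
    (G : EuclideanSpace ℝ (Fin 2) × ℝ →
      C(Metric.closedBall (0 : EuclideanSpace ℝ (Fin 2)) 1, ℝ))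
    (hGr : ∀ w ∈ K, ∀ r ∈ Set.Ioc (0 : ℝ) v₀,
      ∀ u : Metric.closedBall (0 : EuclideanSpace ℝ (Fin 2)) 1,
        G (w, r) u = (φ (w + r • (T w u.val)) - φ w) / r)
    (hG0 : ∀ w ∈ K, ∀ u : Metric.closedBall (0 : EuclideanSpace ℝ (Fin 2)) 1,
      G (w, 0) u = fderiv ℝ φ w (T w u.val)) :
    ContinuousOn G (K ×ˢ Set.Icc (0 : ℝ) v₀) ∧
      IsCompact (G '' (K ×ˢ Set.Icc (0 : ℝ) v₀)) := by
  suffices hG : ContinuousOn G (K ×ˢ Set.Icc (0 : ℝ) v₀) from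
    ⟨hG, (hK.prod isCompact_Icc).image_of_continuousOn hG⟩
  rw [continuousOn_iff_continuous_domRestrict]
  refine ContinuousMap.continuous_of_continuous_uncurry _ ?_
  have hTu : Continuous fun q : (K ×ˢ Set.Icc (0 : ℝ) v₀ : Set _) ×
      Metric.closedBall (0 : EuclideanSpace ℝ (Fin 2)) 1 ↦ T q.1.1.1 q.2.1 := by
    have hTK : Continuous fun q : (K ×ˢ Set.Icc (0 : ℝ) v₀ : Set _) ×
        Metric.closedBall (0 : EuclideanSpace ℝ (Fin 2)) 1 ↦ T q.1.1.1 :=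
      hT.comp_continuous (by fun_prop) fun q ↦ q.1.2.1
    exact hTK.clm_apply (by fun_prop)
  have hmap : Continuous fun q : (K ×ˢ Set.Icc (0 : ℝ) v₀ : Set _) ×
      Metric.closedBall (0 : EuclideanSpace ℝ (Fin 2)) 1 ↦
        (q.1.1.1, q.1.1.2, T q.1.1.1 q.2.1) :=
    Continuous.prodMk (by fun_prop) (Continuous.prodMk (by fun_prop) hTu)
  refine continuous_iff_continuousAt.2 fun q ↦ ?_
  have hq : q.1.1.1 + q.1.1.2 • T q.1.1.1 q.2.1 ∈ U :=
    hdom _ q.1.2.1 _ q.1.2.2 _ (mem_closedBall_zero_iff.1 q.2.2)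
  have hquot := ContinuousAt.comp_of_eq (continuousAt_differenceQuotient
    (hφ.contDiffAt (hU.mem_nhds (hKU q.1.2.1)))
    (hφ.continuousOn.continuousAt (hU.mem_nhds hq))) hmap.continuousAt rfl
  refine hquot.congr (Filter.Eventually.of_forall ?_)
  rintro ⟨⟨⟨w, r⟩, hw, hr⟩, u⟩
  rcases hr.1.eq_or_lt with h0 | hpos
  · obtain rfl : 0 = r := h0
    simp [Function.uncurry, hG0 w hw u]
  · have hpos' : r ≠ 0 := ne_of_gt hpos
    simp [Function.uncurry, hpos', hGr w hw r ⟨hpos, hr.2⟩ u, div_eq_inv_mul]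
end
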